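/- arXiv:0902.4754 — 2 statements merged into one kernel-verified Lean document; each statement's English description precedes it below -/
import Mathlib

section
/- Suppose (δq, δK) is an off-shell infinitesimal symmetry of the smooth Lagrangian L : ℝⁿ × ℝⁿ × ℝ → ℝ. Then the canonical momenta transform as follows: for all (q, v, a, t) ∈ ℝⁿ × ℝⁿ × ℝⁿ × ℝ and all indices A, Σ_B δq^B (∂²L/∂q^B∂v^A) + Σ_B δv^B (∂²L/∂v^B∂v^A) = ∂(δK)/∂q^A − Σ_B (∂(δq^B)/∂q^A)(∂L/∂v^B) + Σ_B (∂(δq^B)/∂v^A)·( D_t[∂L/∂v^B] − ∂L/∂q^B ), where δv^B := Σ_C a^C ∂(δq^B)/∂v^C + Σ_C v^C ∂(δq^B)/∂q^C + ∂(δq^B)/∂t and D_t[∂L/∂v^B] := Σ_C a^C ∂²L/∂v^C∂v^B + Σ_C v^C ∂²L/∂q^C∂v^B + ∂²L/∂t∂v^B. -/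
open scoped BigOperators

/-- Configuration–velocity–time space `(q, v, t)`. -/
abbrev Conf (n : ℕ) : Type := (Fin n → ℝ) × (Fin n → ℝ) × ℝ

/-- Partial derivative `∂f/∂q^A`. -/
noncomputable def pdQ (n : ℕ) (f : Conf n → ℝ) (A : Fin n) (x : Conf n) : ℝ :=
  fderiv ℝ f x (Pi.single A (1 : ℝ), 0, 0)

/-- Partial derivative `∂f/∂v^A`. -/
noncomputable def pdV (n : ℕ) (f : Conf n → ℝ) (A : Fin n) (x : Conf n) : ℝ :=
  fderiv ℝ f x (0, Pi.single A (1 : ℝ), 0)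

/-- Partial derivative `∂f/∂t`. -/
noncomputable def pdT (n : ℕ) (f : Conf n → ℝ) (x : Conf n) : ℝ :=
  fderiv ℝ f x (0, 0, 1)

/-- The induced variation of the velocity,
`δv^A := Σ_B a^B ∂(δq^A)/∂v^B + Σ_B v^B ∂(δq^A)/∂q^B + ∂(δq^A)/∂t`. -/
noncomputable def deltaV (n : ℕ) (δq : Conf n → Fin n → ℝ) (A : Fin n)
    (q v a : Fin n → ℝ) (t : ℝ) : ℝ :=
  (∑ B, a B * pdV n (fun x => δq x A) B (q, v, t))
    + (∑ B, v B * pdQ n (fun x => δq x A) B (q, v, t))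
    + pdT n (fun x => δq x A) (q, v, t)

/-- `(δq, δK)` is an off-shell infinitesimal symmetry of `L`:
`Σ_A δq^A ∂L/∂q^A + Σ_A δv^A ∂L/∂v^A = Σ_B a^B ∂(δK)/∂v^B + Σ_B v^B ∂(δK)/∂q^B + ∂(δK)/∂t`
for all `(q, v, a, t)`. -/
def IsOffShellSymmetry (n : ℕ) (L : Conf n → ℝ) (δq : Conf n → Fin n → ℝ)
    (δK : Conf n → ℝ) : Prop :=
  ∀ (q v a : Fin n → ℝ) (t : ℝ),
    (∑ A, δq (q, v, t) A * pdQ n L A (q, v, t))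
      + (∑ A, deltaV n δq A q v a t * pdV n L A (q, v, t))
    = (∑ B, a B * pdV n δK B (q, v, t))
      + (∑ B, v B * pdQ n δK B (q, v, t))
      + pdT n δK (q, v, t)


/-- The formal total time derivative of the momentum `∂L/∂v^B` on the jet variables
`(q, v, a, t)`:
`D_t[∂L/∂v^B] = Σ_C a^C ∂²L/∂v^C∂v^B + Σ_C v^C ∂²L/∂q^C∂v^B + ∂²L/∂t∂v^B`. -/
noncomputable def DtMom (n : ℕ) (L : Conf n → ℝ) (B : Fin n)
    (q v a : Fin n → ℝ) (t : ℝ) : ℝ :=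
  (∑ C, a C * pdV n (pdV n L B) C (q, v, t))
    + (∑ C, v C * pdQ n (pdV n L B) C (q, v, t))
    + pdT n (pdV n L B) (q, v, t)

section JetSpace

variable {n : ℕ}

/-- The direction `(v, a, 1)` of the total time derivative at the point `x = (q, v, t)`. -/
def jetDir (a : Fin n → ℝ) (x : Conf n) : Conf n := (x.2.1, a, 1)

lemma sum_mul_pdQ (f : Conf n → ℝ) (c : Fin n → ℝ) (x : Conf n) :
    ∑ B, c B * pdQ n f B x = fderiv ℝ f x (c, 0, 0) := by
  have h := LinearMap.pi_apply_eq_sum_univ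
    ((fderiv ℝ f x).toLinearMap.comp (LinearMap.inl ℝ (Fin n → ℝ) ((Fin n → ℝ) × ℝ))) c
  have hs : ∀ i : Fin n, (fun j => if i = j then (1 : ℝ) else 0) = Pi.single i 1 := by
    intro i; ext j; simp [Pi.single_apply, eq_comm]
  simp only [hs] at h
  exact h.symm

lemma sum_mul_pdV (f : Conf n → ℝ) (c : Fin n → ℝ) (x : Conf n) :
    ∑ B, c B * pdV n f B x = fderiv ℝ f x (0, c, 0) := by
  have h := LinearMap.pi_apply_eq_sum_univ
    ((fderiv ℝ f x).toLinearMap.comp ((LinearMap.inr ℝ (Fin n → ℝ) ((Fin n → ℝ) × ℝ)).comp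
      (LinearMap.inl ℝ (Fin n → ℝ) ℝ))) c
  have hs : ∀ i : Fin n, (fun j => if i = j then (1 : ℝ) else 0) = Pi.single i 1 := by
    intro i; ext j; simp [Pi.single_apply, eq_comm]
  simp only [hs] at h
  exact h.symm

/-- The total time derivative is the directional derivative along `jetDir`. -/
lemma sum_add_sum_add_pdT (f : Conf n → ℝ) (q v a : Fin n → ℝ) (t : ℝ) :
    (∑ B, a B * pdV n f B (q, v, t)) + (∑ B, v B * pdQ n f B (q, v, t)) + pdT n f (q, v, t)
      = fderiv ℝ f (q, v, t) (jetDir a (q, v, t)) := by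
  rw [sum_mul_pdV, sum_mul_pdQ, pdT, ← map_add, ← map_add]
  simp [jetDir]

lemma differentiable_fderiv_of_contDiff {E : Type*} [NormedAddCommGroup E] [NormedSpace ℝ E]
    {f : E → ℝ} (hf : ContDiff ℝ (⊤ : ℕ∞) f) : Differentiable ℝ (fderiv ℝ f) :=
  (hf.fderiv_right (m := 1) (by norm_cast)).differentiable one_ne_zero

/-- Directional derivatives along constant vectors commute. -/
lemma fderiv_fderiv_apply_comm {E : Type*} [NormedAddCommGroup E] [NormedSpace ℝ E]
    {f : E → ℝ} (hf : ContDiff ℝ (⊤ : ℕ∞) f) (x u w : E) :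
    fderiv ℝ (fderiv ℝ f) x u w = fderiv ℝ (fderiv ℝ f) x w u :=
  (hf.contDiffAt.isSymmSndFDerivAt (by
    rw [minSmoothness_of_isRCLikeNormedField]; exact WithTop.coe_le_coe.mpr le_top)) u w

lemma fderiv_fderiv_apply_const {E : Type*} [NormedAddCommGroup E] [NormedSpace ℝ E]
    {f : E → ℝ} (hf : ContDiff ℝ (⊤ : ℕ∞) f) (x u w : E) :
    fderiv ℝ (fun y => fderiv ℝ f y u) x w = fderiv ℝ (fderiv ℝ f) x w u := by
  rw [fderiv_clm_apply (differentiable_fderiv_of_contDiff hf x) (differentiableAt_const u)]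
  simp

lemma differentiable_pdV {f : Conf n → ℝ} (hf : ContDiff ℝ (⊤ : ℕ∞) f) (A : Fin n) :
    Differentiable ℝ (pdV n f A) :=
  (differentiable_fderiv_of_contDiff hf).clm_apply (differentiable_const _)

lemma differentiable_pdQ {f : Conf n → ℝ} (hf : ContDiff ℝ (⊤ : ℕ∞) f) (A : Fin n) :
    Differentiable ℝ (pdQ n f A) :=
  (differentiable_fderiv_of_contDiff hf).clm_apply (differentiable_const _)

lemma differentiable_jetDir (a : Fin n → ℝ) : Differentiable ℝ (jetDir a) := by
  unfold jetDir; fun_prop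

lemma fderiv_jetDir (a : Fin n → ℝ) (x : Conf n) (w : Fin n → ℝ) :
    fderiv ℝ (jetDir a) x (0, w, 0) = (w, 0, 0) := by
  have h : HasFDerivAt (jetDir a) (((ContinuousLinearMap.fst ℝ (Fin n → ℝ) ℝ).comp
      (ContinuousLinearMap.snd ℝ (Fin n → ℝ) ((Fin n → ℝ) × ℝ))).prod 0) x :=
    HasFDerivAt.prodMk (ContinuousLinearMap.hasFDerivAt
      ((ContinuousLinearMap.fst ℝ (Fin n → ℝ) ℝ).comp
        (ContinuousLinearMap.snd ℝ (Fin n → ℝ) ((Fin n → ℝ) × ℝ))))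
      (hasFDerivAt_const (a, (1 : ℝ)) x)
  rw [h.fderiv]
  rfl

lemma differentiable_fderiv_jetDir {f : Conf n → ℝ} (hf : ContDiff ℝ (⊤ : ℕ∞) f)
    (a : Fin n → ℝ) : Differentiable ℝ (fun y => fderiv ℝ f y (jetDir a y)) :=
  (differentiable_fderiv_of_contDiff hf).clm_apply (differentiable_jetDir a)

/-- The commutation relation `∂/∂v^A ∘ D_t = D_t ∘ ∂/∂v^A + ∂/∂q^A`. -/
lemma pdV_fderiv_jetDir {f : Conf n → ℝ} (hf : ContDiff ℝ (⊤ : ℕ∞) f) (a : Fin n → ℝ)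
    (A : Fin n) (x : Conf n) :
    pdV n (fun y => fderiv ℝ f y (jetDir a y)) A x
      = fderiv ℝ (pdV n f A) x (jetDir a x) + pdQ n f A x := by
  unfold pdV pdQ
  rw [fderiv_clm_apply (differentiable_fderiv_of_contDiff hf x) (differentiable_jetDir a x),
    fderiv_fderiv_apply_const hf, fderiv_fderiv_apply_comm hf x (jetDir a x)]
  simp [fderiv_jetDir, add_comm]

lemma pdV_pdQ_comm {f : Conf n → ℝ} (hf : ContDiff ℝ (⊤ : ℕ∞) f) (A B : Fin n) (x : Conf n) :
    pdV n (pdQ n f B) A x = pdQ n (pdV n f A) B x := by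
  unfold pdV pdQ
  rw [fderiv_fderiv_apply_const hf, fderiv_fderiv_apply_const hf, fderiv_fderiv_apply_comm hf]

lemma pdV_pdV_comm {f : Conf n → ℝ} (hf : ContDiff ℝ (⊤ : ℕ∞) f) (A B : Fin n) (x : Conf n) :
    pdV n (pdV n f B) A x = pdV n (pdV n f A) B x := by
  unfold pdV
  rw [fderiv_fderiv_apply_const hf, fderiv_fderiv_apply_const hf, fderiv_fderiv_apply_comm hf]

lemma fderiv_sum_mul {f g : Fin n → Conf n → ℝ} (hf : ∀ B, Differentiable ℝ (f B))
    (hg : ∀ B, Differentiable ℝ (g B)) (x u : Conf n) :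
    fderiv ℝ (fun y => ∑ B, f B y * g B y) x u
      = ∑ B, (f B x * fderiv ℝ (g B) x u + fderiv ℝ (f B) x u * g B x) := by
  rw [fderiv_fun_sum fun B _ => (hf B x).fun_mul (hg B x)]
  simp only [sum_apply]
  refine Finset.sum_congr rfl fun B _ => ?_
  rw [fderiv_fun_mul (hf B x) (hg B x)]
  simp [mul_comm]

/-- The symmetry condition written with directional derivatives along `jetDir`. -/
lemma IsOffShellSymmetry.eq_fderiv_jetDir {L δK : Conf n → ℝ} {δq : Conf n → Fin n → ℝ}
    (hsym : IsOffShellSymmetry n L δq δK) (a : Fin n → ℝ) (x : Conf n) :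
    (∑ B, δq x B * pdQ n L B x)
      + (∑ B, fderiv ℝ (fun y => δq y B) x (jetDir a x) * pdV n L B x)
      = fderiv ℝ δK x (jetDir a x) := by
  obtain ⟨q, v, t⟩ := x
  have h := hsym q v a t
  simp only [deltaV, sum_add_sum_add_pdT] at h
  exact h

/-- The part of the symmetry condition linear in the accelerations:
`Σ_B (∂(δq^B)/∂v^A)(∂L/∂v^B) = ∂(δK)/∂v^A`. -/
lemma IsOffShellSymmetry.sum_pdV_mul_pdV {L δK : Conf n → ℝ} {δq : Conf n → Fin n → ℝ}
    (hsym : IsOffShellSymmetry n L δq δK) (A : Fin n) (x : Conf n) :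
    ∑ B, pdV n (fun y => δq y B) A x * pdV n L B x = pdV n δK A x := by
  have h₁ := hsym.eq_fderiv_jetDir (Pi.single A 1) x
  have h₀ := hsym.eq_fderiv_jetDir 0 x
  have hsplit : jetDir (Pi.single A 1) x = jetDir 0 x + (0, Pi.single A (1 : ℝ), 0) := by
    simp [jetDir]
  simp only [hsplit, map_add, add_mul, Finset.sum_add_distrib] at h₁
  simp only [pdV] at h₀ h₁ ⊢
  linarith

end JetSpace

/-- Transformation of the canonical momenta under an off-shell infinitesimal symmetry:
`Σ_B δq^B ∂²L/∂q^B∂v^A + Σ_B δv^B ∂²L/∂v^B∂v^A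
  = ∂(δK)/∂q^A − Σ_B (∂(δq^B)/∂q^A)(∂L/∂v^B)
    + Σ_B (∂(δq^B)/∂v^A)(D_t[∂L/∂v^B] − ∂L/∂q^B)`. -/
theorem offShellSymmetry_momentum_transformation (n : ℕ)
    (L δK : Conf n → ℝ) (δq : Conf n → Fin n → ℝ)
    (hL : ContDiff ℝ (⊤ : ℕ∞) L) (hδK : ContDiff ℝ (⊤ : ℕ∞) δK)
    (hδq : ContDiff ℝ (⊤ : ℕ∞) δq)
    (hsym : IsOffShellSymmetry n L δq δK) :
    ∀ (q v a : Fin n → ℝ) (t : ℝ) (A : Fin n),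
      (∑ B, δq (q, v, t) B * pdQ n (pdV n L A) B (q, v, t))
        + (∑ B, deltaV n δq B q v a t * pdV n (pdV n L A) B (q, v, t))
      = pdQ n δK A (q, v, t)
        - (∑ B, pdQ n (fun x => δq x B) A (q, v, t) * pdV n L B (q, v, t))
        + ∑ B, pdV n (fun x => δq x B) A (q, v, t)
            * (DtMom n L B q v a t - pdQ n L B (q, v, t)) := by
  intro q v a t A
  have hδqB : ∀ B, ContDiff ℝ (⊤ : ℕ∞) (fun y => δq y B) := fun B => contDiff_pi.mp hδq B
  have hdv : pdV n (fun x => (∑ B, δq x B * pdQ n L B x)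
      + (∑ B, fderiv ℝ (fun y => δq y B) x (jetDir a x) * pdV n L B x)) A (q, v, t)
      = pdV n (fun x => fderiv ℝ δK x (jetDir a x)) A (q, v, t) := by
    simp only [hsym.eq_fderiv_jetDir a]
  have hdt : fderiv ℝ (fun x => ∑ B, pdV n (fun y => δq y B) A x * pdV n L B x) (q, v, t)
      (jetDir a (q, v, t)) = fderiv ℝ (pdV n δK A) (q, v, t) (jetDir a (q, v, t)) := by
    simp only [hsym.sum_pdV_mul_pdV A]
  have hd₀ : ∀ B, Differentiable ℝ (fun y => δq y B) :=
    fun B => (hδqB B).differentiable (by simp)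
  have hd₁ : ∀ B, Differentiable ℝ (fun x => fderiv ℝ (fun y => δq y B) x (jetDir a x)) :=
    fun B => differentiable_fderiv_jetDir (hδqB B) a
  rw [fderiv_sum_mul (fun B => differentiable_pdV (hδqB B) A) (differentiable_pdV hL)] at hdt
  rw [pdV_fderiv_jetDir hδK, pdV, fderiv_fun_add
      (DifferentiableAt.fun_sum fun B _ => (hd₀ B _).fun_mul (differentiable_pdQ hL B _))
      (DifferentiableAt.fun_sum fun B _ => (hd₁ B _).fun_mul (differentiable_pdV hL B _)),
    add_apply, fderiv_sum_mul hd₀ (differentiable_pdQ hL),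
    fderiv_sum_mul hd₁ (differentiable_pdV hL)] at hdv
  simp only [← pdV.eq_1, pdV_fderiv_jetDir (hδqB _), pdV_pdQ_comm hL, pdV_pdV_comm hL A,
    Finset.sum_add_distrib, add_mul] at hdv
  simp only [Finset.sum_add_distrib] at hdt
  simp only [deltaV, DtMom, sum_add_sum_add_pdT, mul_sub, Finset.sum_sub_distrib]
  linarith
end

section
/- Suppose (δq, δK) is an off-shell infinitesimal symmetry of the smooth Lagrangian L : ℝⁿ × ℝⁿ × ℝ → ℝ, and let E(q, v, t) := Σ_A v^A (∂L/∂v^A) − L be the energy function. Then for all (q, v, a, t) ∈ ℝⁿ × ℝⁿ × ℝⁿ × ℝ: Σ_A δq^A ∂E/∂q^A + Σ_A δv^A ∂E/∂v^A = Σ_A v^A Σ_B (∂(δq^B)/∂v^A)·( D_t[∂L/∂v^B] − ∂L/∂q^B ) + Σ_A (∂(δq^A)/∂t)(∂L/∂v^A) − ∂(δK)/∂t, where δv^A := Σ_B a^B ∂(δq^A)/∂v^B + Σ_B v^B ∂(δq^A)/∂q^B + ∂(δq^A)/∂t and D_t[∂L/∂v^B] := Σ_C a^C ∂²L/∂v^C∂v^B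 + Σ_C v^C ∂²L/∂q^C∂v^B + ∂²L/∂t∂v^B. -/
open scoped BigOperators

/-- The energy function `E(q, v, t) = Σ_A v^A ∂L/∂v^A − L`. -/
noncomputable def energy (n : ℕ) (L : Conf n → ℝ) : Conf n → ℝ :=
  fun x => (∑ A, x.2.1 A * pdV n L A x) - L x

/-- A linear functional on configuration–velocity–time space in coordinates. -/
theorem clm_conf_apply (n : ℕ) (φ : Conf n →L[ℝ] ℝ) (u b : Fin n → ℝ) (s : ℝ) :
    φ (u, b, s) = (∑ A, u A * φ (Pi.single A (1 : ℝ), 0, 0))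
      + (∑ A, b A * φ (0, Pi.single A (1 : ℝ), 0)) + s * φ (0, 0, 1) := by
  have h : ((u, b, s) : Conf n) = (∑ A, u A • ((Pi.single A (1 : ℝ), 0, 0) : Conf n))
      + (∑ A, b A • ((0, Pi.single A (1 : ℝ), 0) : Conf n)) + s • ((0, 0, 1) : Conf n) := by
    refine Prod.ext ?_ (Prod.ext ?_ ?_)
    · ext i
      simp [Prod.fst_sum, Finset.sum_apply, Pi.single_apply]
    · ext i
      simp [Prod.fst_sum, Prod.snd_sum, Finset.sum_apply, Pi.single_apply]
    · simp [Prod.snd_sum]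
  rw [h]
  simp only [map_add, map_sum, map_smul, smul_eq_mul]

/-- The differential of a function in terms of its partial derivatives. -/
theorem fderiv_conf_apply (n : ℕ) (f : Conf n → ℝ) (x : Conf n) (u b : Fin n → ℝ) (s : ℝ) :
    fderiv ℝ f x (u, b, s)
      = (∑ A, u A * pdQ n f A x) + (∑ A, b A * pdV n f A x) + s * pdT n f x :=
  clm_conf_apply n _ u b s

theorem fderiv_conf_vel_apply (n : ℕ) (f : Conf n → ℝ) (x : Conf n) (b : Fin n → ℝ) :
    fderiv ℝ f x (0, b, 0) = ∑ A, b A * pdV n f A x := by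
  simp [fderiv_conf_apply]

theorem fderiv_conf_pos_apply (n : ℕ) (f : Conf n → ℝ) (x : Conf n) (u : Fin n → ℝ) :
    fderiv ℝ f x (u, 0, 0) = ∑ A, u A * pdQ n f A x := by
  simp [fderiv_conf_apply]

theorem fderiv_component (n : ℕ) {δq : Conf n → Fin n → ℝ} (hδq : Differentiable ℝ δq)
    (A : Fin n) (x w : Conf n) :
    fderiv ℝ (fun y => δq y A) x w = fderiv ℝ δq x w A := by
  rw [((hasFDerivAt_pi'.1 (hδq x).hasFDerivAt) A).fderiv]
  rfl

theorem deltaV_eq_fderiv (n : ℕ) {δq : Conf n → Fin n → ℝ} (hδq : Differentiable ℝ δq)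
    (q v a : Fin n → ℝ) (t : ℝ) (A : Fin n) :
    deltaV n δq A q v a t = fderiv ℝ δq (q, v, t) (v, a, 1) A := by
  rw [← fderiv_component n hδq, fderiv_conf_apply, deltaV]
  ring

theorem differentiable_fderiv_of_smooth {E F : Type*} [NormedAddCommGroup E] [NormedSpace ℝ E]
    [NormedAddCommGroup F] [NormedSpace ℝ F] {f : E → F} (hf : ContDiff ℝ (⊤ : ℕ∞) f) :
    Differentiable ℝ (fderiv ℝ f) :=
  ((contDiff_infty.1 hf 2).fderiv_right (m := 1) (by norm_num)).differentiable one_ne_zero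

theorem second_fderiv_comm {E F : Type*} [NormedAddCommGroup E] [NormedSpace ℝ E]
    [NormedAddCommGroup F] [NormedSpace ℝ F] {f : E → F} (hf : ContDiff ℝ (⊤ : ℕ∞) f)
    (x u w : E) :
    fderiv ℝ (fderiv ℝ f) x u w = fderiv ℝ (fderiv ℝ f) x w u :=
  ((contDiff_infty.1 hf 2).contDiffAt.isSymmSndFDerivAt (by simp)) u w

theorem DtMom_eq_fderiv (n : ℕ) {L : Conf n → ℝ} (hL : ContDiff ℝ (⊤ : ℕ∞) L)
    (q v a : Fin n → ℝ) (t : ℝ) (B : Fin n) :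
    DtMom n L B q v a t
      = fderiv ℝ (fderiv ℝ L) (q, v, t) (v, a, 1) (0, Pi.single B (1 : ℝ), 0) := by
  have h := ((differentiable_fderiv_of_smooth hL (q, v, t)).hasFDerivAt).clm_apply
    (hasFDerivAt_const ((0, Pi.single B (1 : ℝ), 0) : Conf n) (q, v, t))
  have h' : fderiv ℝ (pdV n L B) (q, v, t) (v, a, 1)
      = fderiv ℝ (fderiv ℝ L) (q, v, t) (v, a, 1) (0, Pi.single B (1 : ℝ), 0) := by
    rw [show pdV n L B = fun y => fderiv ℝ L y (0, Pi.single B (1 : ℝ), 0) from rfl, h.fderiv]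
    simp
  rw [← h', fderiv_conf_apply, DtMom]
  ring

theorem energy_eq_fderiv (n : ℕ) (L : Conf n → ℝ) :
    energy n L = fun x => fderiv ℝ L x (0, x.2.1, 0) - L x := by
  funext x
  rw [energy, fderiv_conf_vel_apply]

/-- Inclusion of velocities into configuration–velocity–time space. -/
noncomputable def velIncl (n : ℕ) : (Fin n → ℝ) →L[ℝ] Conf n :=
  (ContinuousLinearMap.inr ℝ (Fin n → ℝ) ((Fin n → ℝ) × ℝ)).comp
    (ContinuousLinearMap.inl ℝ (Fin n → ℝ) ℝ)

/-- Inclusion of positions into configuration–velocity–time space. -/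
noncomputable def posIncl (n : ℕ) : (Fin n → ℝ) →L[ℝ] Conf n :=
  ContinuousLinearMap.inl ℝ (Fin n → ℝ) ((Fin n → ℝ) × ℝ)

/-- Projection of configuration–velocity–time space onto velocities. -/
noncomputable def velProj (n : ℕ) : Conf n →L[ℝ] (Fin n → ℝ) :=
  (ContinuousLinearMap.fst ℝ (Fin n → ℝ) ℝ).comp
    (ContinuousLinearMap.snd ℝ (Fin n → ℝ) ((Fin n → ℝ) × ℝ))

@[simp] theorem velIncl_apply (n : ℕ) (b : Fin n → ℝ) : velIncl n b = (0, b, 0) := rfl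

@[simp] theorem posIncl_apply (n : ℕ) (u : Fin n → ℝ) : posIncl n u = (u, 0, 0) := rfl

@[simp] theorem velProj_apply (n : ℕ) (x : Conf n) : velProj n x = x.2.1 := rfl

/-- The derivative of the energy along a vector. -/
theorem fderiv_energy_apply (n : ℕ) {L : Conf n → ℝ} (hL : ContDiff ℝ (⊤ : ℕ∞) L)
    (x w : Conf n) :
    fderiv ℝ (energy n L) x w
      = fderiv ℝ (fderiv ℝ L) x w (0, x.2.1, 0) + fderiv ℝ L x (0, w.2.1, 0)
        - fderiv ℝ L x w := by
  have hv : HasFDerivAt (fun y : Conf n => velIncl n (velProj n y))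
      ((velIncl n).comp (velProj n)) x := ((velIncl n).comp (velProj n)).hasFDerivAt
  have h := ((differentiable_fderiv_of_smooth hL x).hasFDerivAt.clm_apply hv).sub
    ((hL.differentiable (by simp)) x).hasFDerivAt
  rw [energy_eq_fderiv]
  refine (congrArg (fun φ : Conf n →L[ℝ] ℝ => φ w) h.fderiv).trans ?_
  simp
  ring

/-- The coordinate-free form of the off-shell symmetry condition. -/
theorem IsOffShellSymmetry.fderiv_eq {n : ℕ} {L δK : Conf n → ℝ} {δq : Conf n → Fin n → ℝ}
    (hδq : Differentiable ℝ δq) (hsym : IsOffShellSymmetry n L δq δK)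
    (x : Conf n) (a : Fin n → ℝ) :
    fderiv ℝ L x (posIncl n (δq x) + velIncl n (fderiv ℝ δq x (x.2.1, a, 1)))
      = fderiv ℝ δK x (x.2.1, a, 1) := by
  obtain ⟨q, v, t⟩ := x
  have h := hsym q v a t
  simp only [deltaV_eq_fderiv n hδq] at h
  rw [map_add, posIncl_apply, velIncl_apply, fderiv_conf_pos_apply, fderiv_conf_vel_apply, h,
    fderiv_conf_apply]
  ring

/-- The part of the symmetry condition that is linear in the acceleration. -/
theorem IsOffShellSymmetry.fderiv_vel_eq {n : ℕ} {L δK : Conf n → ℝ}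
    {δq : Conf n → Fin n → ℝ} (hδq : Differentiable ℝ δq)
    (hsym : IsOffShellSymmetry n L δq δK) (x : Conf n) (b : Fin n → ℝ) :
    fderiv ℝ L x (velIncl n (fderiv ℝ δq x (0, b, 0))) = fderiv ℝ δK x (0, b, 0) := by
  have h₁ := hsym.fderiv_eq hδq x b
  have h₀ := hsym.fderiv_eq hδq x 0
  have hw : ((x.2.1, b, 1) : Conf n) = (x.2.1, 0, 1) + (0, b, 0) := by simp
  rw [hw] at h₁
  simp only [map_add] at h₁ h₀
  linarith

/-- The variation of the momentum, contracted with a velocity vector `u`. -/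
theorem IsOffShellSymmetry.second_fderiv_eq {n : ℕ} {L δK : Conf n → ℝ}
    {δq : Conf n → Fin n → ℝ} (hL : ContDiff ℝ (⊤ : ℕ∞) L) (hδK : ContDiff ℝ (⊤ : ℕ∞) δK)
    (hδq : ContDiff ℝ (⊤ : ℕ∞) δq) (hsym : IsOffShellSymmetry n L δq δK)
    (x : Conf n) (a u : Fin n → ℝ) :
    fderiv ℝ (fderiv ℝ L) x (posIncl n (δq x) + velIncl n (fderiv ℝ δq x (x.2.1, a, 1)))
        (0, u, 0)
      = fderiv ℝ (fderiv ℝ L) x (x.2.1, a, 1) (velIncl n (fderiv ℝ δq x (0, u, 0)))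
        - fderiv ℝ L x (posIncl n (fderiv ℝ δq x (0, u, 0)))
        - fderiv ℝ L x (velIncl n (fderiv ℝ δq x (u, 0, 0)))
        + fderiv ℝ δK x (u, 0, 0) := by
  have dq : Differentiable ℝ δq := hδq.differentiable (by simp)
  have hL₂ := (differentiable_fderiv_of_smooth hL x).hasFDerivAt
  have hK₂ := (differentiable_fderiv_of_smooth hδK x).hasFDerivAt
  have hq₂ := (differentiable_fderiv_of_smooth hδq x).hasFDerivAt
  have hw : HasFDerivAt (fun y : Conf n => ((y.2.1, a, 1) : Conf n))
      ((posIncl n).comp (velProj n)) x := by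
    have h := ((posIncl n).comp (velProj n)).hasFDerivAt (x := x) |>.add_const
      ((0, a, 1) : Conf n)
    refine h.congr_of_eventuallyEq (Filter.Eventually.of_forall fun y => ?_)
    simp
  have hlhs := hL₂.clm_apply (((posIncl n).hasFDerivAt.comp x (dq x).hasFDerivAt).add
    ((velIncl n).hasFDerivAt.comp x (hq₂.clm_apply hw)))
  have hrhs := hK₂.clm_apply hw
  have e₁ := congrArg (fun φ => φ ((0, u, 0) : Conf n)) (hlhs.unique
    (hrhs.congr_of_eventuallyEq (Filter.Eventually.of_forall fun y =>
      hsym.fderiv_eq dq y a)))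
  have hc := hasFDerivAt_const (𝕜 := ℝ) ((0, u, 0) : Conf n) x
  have hlhs' := hL₂.clm_apply ((velIncl n).hasFDerivAt.comp x (hq₂.clm_apply hc))
  have hrhs' := hK₂.clm_apply hc
  have e₂ := congrArg (fun φ => φ ((x.2.1, a, 1) : Conf n)) (hlhs'.unique
    (hrhs'.congr_of_eventuallyEq (Filter.Eventually.of_forall fun y =>
      hsym.fderiv_vel_eq dq y u)))
  have sL := second_fderiv_comm hL x (0, u, 0)
    (posIncl n (δq x) + velIncl n (fderiv ℝ δq x (x.2.1, a, 1)))
  have sK := second_fderiv_comm hδK x (0, u, 0) (x.2.1, a, 1)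
  have sq := second_fderiv_comm hδq x (0, u, 0) (x.2.1, a, 1)
  simp only [add_apply, ContinuousLinearMap.comp_apply,
    ContinuousLinearMap.flip_apply, Function.comp_apply, Pi.add_apply, velProj_apply,
    zero_apply, map_zero, zero_add, map_add, sq] at e₁ e₂ sL ⊢
  simp only [posIncl_apply, velIncl_apply] at e₁ e₂ sL ⊢
  linarith

/-- Transformation of the energy under an off-shell infinitesimal symmetry:
`Σ_A δq^A ∂E/∂q^A + Σ_A δv^A ∂E/∂v^A
  = Σ_A v^A Σ_B (∂(δq^B)/∂v^A)(D_t[∂L/∂v^B] − ∂L/∂q^B)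
    + Σ_A (∂(δq^A)/∂t)(∂L/∂v^A) − ∂(δK)/∂t`. -/
theorem offShellSymmetry_energy_transformation (n : ℕ)
    (L δK : Conf n → ℝ) (δq : Conf n → Fin n → ℝ)
    (hL : ContDiff ℝ (⊤ : ℕ∞) L) (hδK : ContDiff ℝ (⊤ : ℕ∞) δK)
    (hδq : ContDiff ℝ (⊤ : ℕ∞) δq)
    (hsym : IsOffShellSymmetry n L δq δK) :
    ∀ (q v a : Fin n → ℝ) (t : ℝ),
      (∑ A, δq (q, v, t) A * pdQ n (energy n L) A (q, v, t))
        + (∑ A, deltaV n δq A q v a t * pdV n (energy n L) A (q, v, t))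
      = (∑ A, v A * ∑ B, pdV n (fun x => δq x B) A (q, v, t)
            * (DtMom n L B q v a t - pdQ n L B (q, v, t)))
        + (∑ A, pdT n (fun x => δq x A) (q, v, t) * pdV n L A (q, v, t))
        - pdT n δK (q, v, t) := by
  intro q v a t
  have dq : Differentiable ℝ δq := hδq.differentiable (by simp)
  set x : Conf n := (q, v, t) with hx
  have hE := fderiv_energy_apply n hL x
    (posIncl n (δq x) + velIncl n (fderiv ℝ δq x (v, a, 1)))
  have hS := hsym.fderiv_eq dq x a
  have hV := hsym.fderiv_vel_eq dq x a
  have hM := hsym.second_fderiv_eq hL hδK hδq x a v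
  have lhs : (∑ A, δq x A * pdQ n (energy n L) A x)
      + (∑ A, deltaV n δq A q v a t * pdV n (energy n L) A x)
      = fderiv ℝ (energy n L) x
        (posIncl n (δq x) + velIncl n (fderiv ℝ δq x (v, a, 1))) := by
    simp only [deltaV_eq_fderiv n dq]
    rw [map_add, posIncl_apply, velIncl_apply, fderiv_conf_pos_apply, fderiv_conf_vel_apply]
  have hcomp : ∀ B, ∑ A, v A * pdV n (fun y => δq y B) A x = fderiv ℝ δq x (0, v, 0) B := by
    intro B
    rw [← fderiv_component n dq, fderiv_conf_vel_apply]
  have rhs₁ : (∑ A, v A * ∑ B, pdV n (fun y => δq y B) A x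
        * (DtMom n L B q v a t - pdQ n L B x))
      = fderiv ℝ (fderiv ℝ L) x (v, a, 1) (velIncl n (fderiv ℝ δq x (0, v, 0)))
        - fderiv ℝ L x (posIncl n (fderiv ℝ δq x (0, v, 0))) := by
    rw [posIncl_apply, velIncl_apply, fderiv_conf_pos_apply,
      clm_conf_apply n (fderiv ℝ (fderiv ℝ L) x (v, a, 1))]
    simp only [← DtMom_eq_fderiv n hL, hx, Pi.zero_apply, zero_mul, Finset.sum_const_zero,
      zero_add, add_zero, ← Finset.sum_sub_distrib, ← mul_sub]
    simp only [Finset.mul_sum]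
    rw [Finset.sum_comm]
    refine Finset.sum_congr rfl fun B _ => ?_
    rw [← hx, ← hcomp B, Finset.sum_mul]
    exact Finset.sum_congr rfl fun A _ => by ring
  have rhs₂ : (∑ A, pdT n (fun y => δq y A) x * pdV n L A x)
      = fderiv ℝ L x (velIncl n (fderiv ℝ δq x (0, 0, 1))) := by
    rw [velIncl_apply, fderiv_conf_vel_apply]
    exact Finset.sum_congr rfl fun A _ => by rw [← fderiv_component n dq]; rfl
  rw [lhs, rhs₁, rhs₂, show pdT n δK x = fderiv ℝ δK x (0, 0, 1) from rfl, hE]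
  have hw : ((v, a, 1) : Conf n) = (v, 0, 0) + (0, a, 0) + (0, 0, 1) := by simp
  have hξ : ((0, (posIncl n (δq x) + velIncl n (fderiv ℝ δq x (v, a, 1))).2.1, 0) : Conf n)
      = velIncl n (fderiv ℝ δq x (v, 0, 0)) + velIncl n (fderiv ℝ δq x (0, a, 0))
        + velIncl n (fderiv ℝ δq x (0, 0, 1)) := by
    rw [← map_add, ← map_add, ← map_add, ← map_add, ← hw]
    simp
  have hK : fderiv ℝ δK x (v, a, 1) = fderiv ℝ δK x (v, 0, 0) + fderiv ℝ δK x (0, a, 0)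
      + fderiv ℝ δK x (0, 0, 1) := by
    rw [hw, map_add, map_add]
  have hL' := congrArg (fderiv ℝ L x) hξ
  rw [map_add, map_add] at hL'
  linarith
end
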